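/- arXiv:1606.08338 — 3 statements merged into one kernel-verified Lean document; each statement's English description precedes it below -/
import Mathlib

section
/- Let A be a Banach algebra and φ ∈ Δ(A). Suppose A is approximately left φ-biprojective and there exists an element a₀ ∈ A such that a·a₀ = a₀·a for all a ∈ A and φ(a₀) = 1. Then A is approximately left φ-amenable. -/
open Filter Topology

universe u

/-! ## Nets indexed by directed sets -/

/-- A (nonempty) directed index type, used to index nets. -/
structure DirSys : Type (u + 1) where
  ι : Type u
  [pre : Preorder ι]
  [dir : IsDirected ι (· ≤ ·)]
  [ne : Nonempty ι]

attribute [instance] DirSys.pre DirSys.dir DirSys.ne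

section Core

variable (A : Type u) [NonUnitalNormedRing A] [NormedSpace ℂ A]
  [IsScalarTower ℂ A A] [SMulCommClass ℂ A A]

/-- A realization of the projective tensor product `A ⊗̂ A` of a Banach algebra `A` with
itself, together with its canonical Banach `A`-bimodule structure and the product
(diagonal) map `π_A`.  The field `universal` is the universal property of the projective
tensor norm, which pins the object down uniquely up to isometric isomorphism. -/
structure ProjTensorSq (X : Type u) [NormedAddCommGroup X] [NormedSpace ℂ X]
    [CompleteSpace X] : Type (u + 1) where
  /-- the canonical bilinear map `(a, b) ↦ a ⊗ b` -/
  tmul : A →L[ℂ] A →L[ℂ] X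
  /-- the projective norm is a cross norm -/
  norm_tmul : ∀ a b : A, ‖tmul a b‖ = ‖a‖ * ‖b‖
  /-- elementary tensors span a dense subspace -/
  dense_span : Dense (Submodule.span ℂ (Set.range fun p : A × A => tmul p.1 p.2) : Set X)
  /-- the universal property of the projective tensor product -/
  universal : ∀ (Y : Type u) [NormedAddCommGroup Y] [NormedSpace ℂ Y] [CompleteSpace Y]
      (f : A →L[ℂ] A →L[ℂ] Y), ∃ g : X →L[ℂ] Y, ‖g‖ ≤ ‖f‖ ∧ ∀ a b : A, g (tmul a b) = f a b
  /-- the left module action `a · (b ⊗ c) = (a * b) ⊗ c` -/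
  lsmul : A →L[ℂ] X →L[ℂ] X
  lsmul_tmul : ∀ a b c : A, lsmul a (tmul b c) = tmul (a * b) c
  /-- the right module action `(b ⊗ c) · a = b ⊗ (c * a)` -/
  rsmul : A →L[ℂ] X →L[ℂ] X
  rsmul_tmul : ∀ a b c : A, rsmul a (tmul b c) = tmul b (c * a)
  /-- the product map `π_A`, determined by `π_A (a ⊗ b) = a * b` -/
  projL : X →L[ℂ] A
  projL_tmul : ∀ a b : A, projL (tmul a b) = a * b

variable {A}

/-- `A` is approximately left `φ`-biprojective:  there is a net `(ρ_α)` of bounded linear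
maps `A → A ⊗̂ A` with `a·ρ_α(x) - ρ_α(ax) → 0`, `ρ_α(xa) - φ(a)ρ_α(x) → 0` and
`φ(π_A(ρ_α(x))) → φ(x)` for all `a x : A`. -/
def ApproxLeftBiprojective (φ : WeakDual.characterSpace ℂ A) : Prop :=
  ∀ (X : Type u) [NormedAddCommGroup X] [NormedSpace ℂ X] [CompleteSpace X]
    (P : ProjTensorSq A X),
    ∃ (D : DirSys.{u}) (ρ : D.ι → (A →L[ℂ] X)),
      (∀ a x : A, Tendsto (fun i => P.lsmul a (ρ i x) - ρ i (a * x)) atTop (𝓝 0)) ∧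
      (∀ a x : A, Tendsto (fun i => ρ i (x * a) - φ a • ρ i x) atTop (𝓝 0)) ∧
      (∀ x : A, Tendsto (fun i => φ (P.projL (ρ i x))) atTop (𝓝 (φ x)))

/-- `A` is approximately left character biprojective if it is approximately left
`φ`-biprojective for every character `φ` of `A`. -/
def ApproxLeftCharBiprojective : Prop :=
  ∀ φ : WeakDual.characterSpace ℂ A, ApproxLeftBiprojective φ

/-- `A` is approximately left `φ`-amenable: there is a (not necessarily bounded) net
`(a_α)` in `A` with `‖a * a_α - φ(a) a_α‖ → 0` for every `a` and `φ(a_α) → 1`. -/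
def ApproxLeftAmenable (φ : WeakDual.characterSpace ℂ A) : Prop :=
  ∃ (D : DirSys.{u}) (v : D.ι → A),
    (∀ a : A, Tendsto (fun i => a * v i - φ a • v i) atTop (𝓝 0)) ∧
    Tendsto (fun i => φ (v i)) atTop (𝓝 1)

/-- `A` is approximately biprojective (Zhang): there is a net `(ρ_α)` of bounded
`A`-bimodule morphisms `A → A ⊗̂ A` with `π_A(ρ_α(a)) → a` for every `a`. -/
def ApproxBiprojective : Prop :=
  ∀ (X : Type u) [NormedAddCommGroup X] [NormedSpace ℂ X] [CompleteSpace X]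
    (P : ProjTensorSq A X),
    ∃ (D : DirSys.{u}) (ρ : D.ι → (A →L[ℂ] X)),
      (∀ i, ∀ a b : A, ρ i (a * b) = P.lsmul a (ρ i b)) ∧
      (∀ i, ∀ a b : A, ρ i (a * b) = P.rsmul b (ρ i a)) ∧
      (∀ a : A, Tendsto (fun i => P.projL (ρ i a)) atTop (𝓝 a))

/-- `A` is pseudo-amenable: there is a (not necessarily bounded) net `(m_α)` in `A ⊗̂ A`
with `a·m_α - m_α·a → 0` and `π_A(m_α) a → a` for every `a`. -/
def PseudoAmenable : Prop :=
  ∀ (X : Type u) [NormedAddCommGroup X] [NormedSpace ℂ X] [CompleteSpace X]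
    (P : ProjTensorSq A X),
    ∃ (D : DirSys.{u}) (m : D.ι → X),
      (∀ a : A, Tendsto (fun i => P.lsmul a (m i) - P.rsmul a (m i)) atTop (𝓝 0)) ∧
      (∀ a : A, Tendsto (fun i => P.projL (m i) * a - a) atTop (𝓝 0))

end Core

namespace ProjTensor

section Construction

set_option maxSynthPendingDepth 3

variable (E : Type*) [NormedAddCommGroup E] [NormedSpace ℂ E]

/-- Evaluation of bounded bilinear forms at a pair of vectors. -/
noncomputable def evalPair : E →L[ℂ] E →L[ℂ] (E →L[ℂ] E →L[ℂ] ℂ) →L[ℂ] ℂ :=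
  ((ContinuousLinearMap.flipₗᵢ ℂ (E →L[ℂ] E →L[ℂ] ℂ) E ℂ).toContinuousLinearEquiv :
      _ →L[ℂ] _) ∘L (ContinuousLinearMap.id ℂ (E →L[ℂ] E →L[ℂ] ℂ)).flip

@[simp]
theorem evalPair_apply (a b : E) (f : E →L[ℂ] E →L[ℂ] ℂ) : evalPair E a b f = f a b := rfl

theorem norm_evalPair (a b : E) : ‖evalPair E a b‖ = ‖a‖ * ‖b‖ := by
  apply le_antisymm
  · refine ContinuousLinearMap.opNorm_le_bound _ (by positivity) fun f => ?_
    rw [evalPair_apply, mul_comm, ← mul_assoc]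
    exact f.le_opNorm₂ a b
  · obtain ⟨g, hg, hga⟩ := exists_dual_vector'' ℂ a
    obtain ⟨h, hh, hhb⟩ := exists_dual_vector'' ℂ b
    have hnorm : ‖g.smulRight h‖ ≤ 1 := by
      rw [ContinuousLinearMap.norm_smulRight_apply]
      exact mul_le_one₀ hg (norm_nonneg _) hh
    have := (evalPair E a b).le_of_opNorm_le_of_le le_rfl hnorm
    simpa [hga, hhb] using this

/-- The span of the elementary tensors, inside the dual of the space of bounded bilinear forms. -/
noncomputable def elementarySpan : Submodule ℂ ((E →L[ℂ] E →L[ℂ] ℂ) →L[ℂ] ℂ) :=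
  Submodule.span ℂ (Set.range fun p : E × E => evalPair E p.1 p.2)

/-- The completed projective tensor square, as a closed subspace of the dual of the space of
bounded bilinear forms. -/
def Completion : Type _ := (elementarySpan E).topologicalClosure

noncomputable instance : NormedAddCommGroup (Completion E) :=
  Submodule.normedAddCommGroup (elementarySpan E).topologicalClosure

noncomputable instance : NormedSpace ℂ (Completion E) :=
  Submodule.normedSpace (elementarySpan E).topologicalClosure

instance : CompleteSpace (Completion E) :=
  (Submodule.isClosed_topologicalClosure (elementarySpan E)).completeSpace_coe

/-- The defining inclusion of the completed projective tensor square. -/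
noncomputable def inclusion : Completion E →ₗᵢ[ℂ] (E →L[ℂ] E →L[ℂ] ℂ) →L[ℂ] ℂ :=
  (elementarySpan E).topologicalClosure.subtypeₗᵢ

theorem evalPair_mem (a b : E) : evalPair E a b ∈ (elementarySpan E).topologicalClosure :=
  Submodule.le_topologicalClosure _ (Submodule.subset_span ⟨(a, b), rfl⟩)

/-- The elementary tensor map into the completed projective tensor square. -/
noncomputable def tmul : E →L[ℂ] E →L[ℂ] Completion E :=
  LinearMap.mkContinuous₂
    (LinearMap.mk₂ ℂ (fun a b => (⟨evalPair E a b, evalPair_mem E a b⟩ : Completion E))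
      (fun a a' b => (inclusion E).injective (congrArg (· b) (map_add (evalPair E) a a')))
      (fun c a b => (inclusion E).injective (congrArg (· b) (map_smul (evalPair E) c a)))
      (fun a b b' => (inclusion E).injective (map_add (evalPair E a) b b'))
      (fun c a b => (inclusion E).injective (map_smul (evalPair E a) c b)))
    1 (fun a b => by
      rw [one_mul]
      exact (norm_evalPair E a b).le)

theorem dense_span_tmul :
    Dense (Submodule.span ℂ (Set.range fun p : E × E => tmul E p.1 p.2) : Set (Completion E)) := by
  have himage : (inclusion E '' (Submodule.span ℂ (Set.range fun p : E × E => tmul E p.1 p.2) :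
      Set (Completion E))) = elementarySpan E := by
    rw [← LinearIsometry.coe_toLinearMap, ← Submodule.map_coe, Submodule.map_span, ← Set.range_comp]
    rfl
  refine fun x => (inclusion E).isometry.isEmbedding.closure_eq_preimage_closure_image _ ▸ ?_
  rw [himage]
  exact x.2

variable {E}

theorem exists_lift {Y : Type*} [NormedAddCommGroup Y] [NormedSpace ℂ Y] [CompleteSpace Y]
    (f : E →L[ℂ] E →L[ℂ] Y) :
    ∃ g : Completion E →L[ℂ] Y, ‖g‖ ≤ ‖f‖ ∧ ∀ a b : E, g (tmul E a b) = f a b := by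
  let K : (Y →L[ℂ] ℂ) →L[ℂ] E →L[ℂ] E →L[ℂ] ℂ :=
    LinearMap.mkContinuous
      { toFun := fun y => (ContinuousLinearMap.compL ℂ E Y ℂ y) ∘L f
        map_add' := fun _ _ => by ext; simp
        map_smul' := fun _ _ => by ext; simp }
      ‖f‖ (fun y => by
        refine ContinuousLinearMap.opNorm_le_bound₂ _ (by positivity) fun a b => ?_
        calc ‖y (f a b)‖ ≤ ‖y‖ * (‖f‖ * ‖a‖ * ‖b‖) := y.le_opNorm_of_le (f.le_opNorm₂ a b)
          _ = ‖f‖ * ‖y‖ * ‖a‖ * ‖b‖ := by ring)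
  have hK : ‖K‖ ≤ ‖f‖ := LinearMap.mkContinuous_norm_le _ (norm_nonneg _) _
  let G : ((E →L[ℂ] E →L[ℂ] ℂ) →L[ℂ] ℂ) →L[ℂ] (Y →L[ℂ] ℂ) →L[ℂ] ℂ :=
    (ContinuousLinearMap.compL ℂ _ _ ℂ).flip K
  let J := NormedSpace.inclusionInDoubleDualLi ℂ (E := Y)
  have hG : ∀ a b, G (evalPair E a b) = J (f a b) := fun _ _ => rfl
  have hclosed : IsClosed (LinearMap.range J.toLinearMap : Set ((Y →L[ℂ] ℂ) →L[ℂ] ℂ)) :=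
    J.isometry.isClosedEmbedding.isClosed_range
  have hrange : ∀ x : Completion E, G (inclusion E x) ∈ LinearMap.range J.toLinearMap := by
    have hle : (elementarySpan E).topologicalClosure ≤
        (LinearMap.range J.toLinearMap).comap G.toLinearMap := by
      refine Submodule.topologicalClosure_minimal _ (Submodule.span_le.2 ?_)
        (hclosed.preimage G.continuous)
      rintro _ ⟨p, rfl⟩
      exact ⟨f p.1 p.2, (hG p.1 p.2).symm⟩
    exact fun x => hle x.2
  let g : Completion E →L[ℂ] Y :=
    (J.equivRange.symm.toContinuousLinearEquiv : _ →L[ℂ] Y) ∘L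
      (G ∘L (inclusion E).toContinuousLinearMap).codRestrict _ hrange
  have hJg : ∀ x : Completion E, J (g x) = G (inclusion E x) := fun x =>
    congrArg Subtype.val (J.equivRange.apply_symm_apply ⟨G (inclusion E x), hrange x⟩)
  refine ⟨g, ContinuousLinearMap.opNorm_le_bound _ (norm_nonneg _) fun x => ?_, fun a b => ?_⟩
  · rw [← J.norm_map, hJg, mul_comm, ← (inclusion E).norm_map]
    exact (ContinuousLinearMap.opNorm_comp_le _ K).trans
      (mul_le_mul_of_nonneg_left hK (norm_nonneg _))
  · exact J.injective ((hJg _).trans (hG a b))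

end Construction

set_option maxSynthPendingDepth 3 in
theorem nonempty_projTensorSq (A : Type u) [NonUnitalNormedRing A] [NormedSpace ℂ A]
    [IsScalarTower ℂ A A] [SMulCommClass ℂ A A] [CompleteSpace A] :
    Nonempty (ProjTensorSq A (Completion A)) := by
  let M := ContinuousLinearMap.mul ℂ A
  obtain ⟨p, -, hp⟩ := exists_lift M
  obtain ⟨l, -, hl⟩ := exists_lift (E := A) (Y := A →L[ℂ] Completion A)
    ((ContinuousLinearMap.flipₗᵢ ℂ A A (Completion A)).toContinuousLinearEquiv.toContinuousLinearMap
      ∘L ContinuousLinearMap.compL ℂ A A (A →L[ℂ] Completion A) (tmul A) ∘L M.flip)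
  obtain ⟨r, -, hr⟩ := exists_lift (E := A) (Y := A →L[ℂ] Completion A)
    ((ContinuousLinearMap.compL ℂ A (A →L[ℂ] A) (A →L[ℂ] Completion A)).flip M
      ∘L ContinuousLinearMap.compL ℂ A A (Completion A) ∘L tmul A)
  exact ⟨{
    tmul := tmul A
    norm_tmul := norm_evalPair A
    dense_span := dense_span_tmul A
    universal := fun _ _ _ _ f => exists_lift f
    lsmul := l.flip
    lsmul_tmul := fun a b c => by
      rw [ContinuousLinearMap.flip_apply, hl]
      rfl
    rsmul := r.flip
    rsmul_tmul := fun a b c => by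
      rw [ContinuousLinearMap.flip_apply, hr]
      rfl
    projL := p
    projL_tmul := hp }⟩

end ProjTensor

namespace ProjTensorSq

variable {A : Type u} [NonUnitalNormedRing A] [NormedSpace ℂ A]
  {X : Type u} [NormedAddCommGroup X] [NormedSpace ℂ X] [CompleteSpace X]

theorem clm_ext {F : Type*} [NormedAddCommGroup F] [NormedSpace ℂ F] (P : ProjTensorSq A X)
    {S T : X →L[ℂ] F} (h : ∀ a b, S (P.tmul a b) = T (P.tmul a b)) : S = T := by
  refine ContinuousLinearMap.ext_on P.dense_span ?_
  rintro _ ⟨p, rfl⟩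
  exact h p.1 p.2

/-- The slice map `id ⊗ φ`. -/
theorem exists_slice [IsScalarTower ℂ A A] [SMulCommClass ℂ A A] [CompleteSpace A]
    (P : ProjTensorSq A X) (φ : WeakDual.characterSpace ℂ A) :
    ∃ T : X →L[ℂ] A, (∀ a x, T (P.lsmul a x) = a * T x) ∧ ∀ x, φ (T x) = φ (P.projL x) := by
  let φ' : A →L[ℂ] ℂ := WeakDual.CharacterSpace.toCLM φ
  have hφ' : ∀ a, φ' a = φ a := fun _ => rfl
  obtain ⟨T, -, hT⟩ := P.universal A (ContinuousLinearMap.smulRightL ℂ A A φ')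
  have hT' : ∀ a b, T (P.tmul a b) = φ b • a := hT
  refine ⟨T, fun a x => ?_, fun x => ?_⟩
  · have : T ∘L P.lsmul a = ContinuousLinearMap.mul ℂ A a ∘L T :=
      P.clm_ext fun b c => by simp [P.lsmul_tmul, hT']
    exact DFunLike.congr_fun this x
  · have : φ' ∘L T = φ' ∘L P.projL :=
      P.clm_ext fun b c => by simp [P.projL_tmul, hT', hφ', mul_comm]
    exact DFunLike.congr_fun this x

end ProjTensorSq

/-- Proposition 2.1.  Let `A` be a Banach algebra and `φ ∈ Δ(A)`.
Suppose `A` is approximately left `φ`-biprojective and there exists `a₀ ∈ A` such that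
`a * a₀ = a₀ * a` for all `a ∈ A` and `φ(a₀) = 1`.  Then `A` is approximately left
`φ`-amenable. -/
theorem approxLeftBiprojective_central_element_implies_approxLeftAmenable
    {A : Type u} [NonUnitalNormedRing A] [NormedSpace ℂ A]
    [IsScalarTower ℂ A A] [SMulCommClass ℂ A A] [CompleteSpace A]
    (φ : WeakDual.characterSpace ℂ A)
    (hbiproj : ApproxLeftBiprojective φ)
    (a₀ : A) (hcomm : ∀ a : A, a * a₀ = a₀ * a) (ha₀ : φ a₀ = 1) :
    ApproxLeftAmenable φ := by
  obtain ⟨P⟩ := ProjTensor.nonempty_projTensorSq A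
  obtain ⟨T, hTmul, hTφ⟩ := P.exists_slice φ
  obtain ⟨D, ρ, hl, hr, hφ⟩ := hbiproj _ P
  refine ⟨D, fun i => T (ρ i a₀), fun a => ?_, ?_⟩
  · have h := (T.continuous.tendsto _).comp ((hl a a₀).add (hr a a₀))
    rw [add_zero, map_zero] at h
    refine h.congr fun i => ?_
    simp [hTmul, hcomm]
  · simpa only [hTφ, ha₀] using hφ a₀
end

section
/- Let A be a Banach algebra and φ ∈ Δ(A). If A is approximately left φ-amenable, then A is approximately left φ-biprojective. -/
open Filter Topology

universe u

/-- A character of an algebra takes the value `1`. -/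
theorem characterSpace_exists_apply_eq_one {A : Type*} [NonUnitalNormedRing A] [NormedSpace ℂ A]
    (φ : WeakDual.characterSpace ℂ A) : ∃ w : A, φ w = 1 := by
  obtain ⟨b, hb⟩ : ∃ b, φ b ≠ 0 := by
    by_contra! h
    exact φ.2.1 (ContinuousLinearMap.ext h)
  exact ⟨(φ b)⁻¹ • b, by rw [map_smul, smul_eq_mul, inv_mul_cancel₀ hb]⟩

/-- Proposition 2.4.  Let `A` be a Banach algebra and `φ ∈ Δ(A)`.
If `A` is approximately left `φ`-amenable, then `A` is approximately left
`φ`-biprojective. -/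
theorem approxLeftAmenable_implies_approxLeftBiprojective
    {A : Type u} [NonUnitalNormedRing A] [NormedSpace ℂ A]
    [IsScalarTower ℂ A A] [SMulCommClass ℂ A A] [CompleteSpace A]
    (φ : WeakDual.characterSpace ℂ A)
    (hamen : ApproxLeftAmenable φ) :
    ApproxLeftBiprojective φ := by
  intro X _ _ _ P
  obtain ⟨D, v, hv, hφv⟩ := hamen
  obtain ⟨w, hw⟩ := characterSpace_exists_apply_eq_one φ
  have hρ (i : D.ι) (x : A) : (WeakDual.CharacterSpace.toCLM φ).smulRight (P.tmul (v i) w) x =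
      φ x • P.tmul (v i) w := rfl
  refine ⟨D, fun i => (WeakDual.CharacterSpace.toCLM φ).smulRight (P.tmul (v i) w),
    fun a x => ?_, fun a x => ?_, fun x => ?_⟩
  · have h := ((P.tmul.flip w).continuous.tendsto 0).comp (hv a) |>.const_smul (φ x)
    rw [map_zero, smul_zero] at h
    refine h.congr fun i => ?_
    simp only [hρ, Function.comp_apply, map_sub, map_smul, map_mul, P.lsmul_tmul,
      ContinuousLinearMap.flip_apply, smul_sub, smul_smul, mul_comm (φ a)]
  · refine tendsto_const_nhds.congr fun i => ?_
    simp only [hρ, map_mul, smul_smul, mul_comm (φ a), sub_self]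
  · have h := hφv.const_mul (φ x)
    rw [mul_one] at h
    refine h.congr fun i => ?_
    simp only [hρ, map_smul, P.projL_tmul, map_mul, hw, mul_one, smul_eq_mul]
end

section
/- Let A be a Banach algebra, φ ∈ Δ(A), and let I be a closed two-sided ideal of A with φ|_I ≠ 0. If A is approximately left φ-biprojective, then the Banach algebra I is approximately left φ|_I-biprojective. -/
open Filter Topology

universe u

/-! ## Existence of the projective tensor square -/

section Construction

set_option maxSynthPendingDepth 3

variable (E : Type*) [NormedAddCommGroup E] [NormedSpace ℂ E]

/-- Evaluation of bounded bilinear forms at a pair of vectors. -/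
noncomputable def bilinEval : E →L[ℂ] E →L[ℂ] StrongDual ℂ (E →L[ℂ] E →L[ℂ] ℂ) :=
  (ContinuousLinearMap.flip (ContinuousLinearMap.compL ℂ (E →L[ℂ] E →L[ℂ] ℂ) (E →L[ℂ] ℂ) ℂ ∘L
    ContinuousLinearMap.apply ℂ ℂ) ∘L ContinuousLinearMap.apply ℂ (E →L[ℂ] ℂ))

/-- The projective tensor square, realized inside the dual of the bounded bilinear forms. -/
noncomputable def projTensorSpace : Submodule ℂ (StrongDual ℂ (E →L[ℂ] E →L[ℂ] ℂ)) :=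
  (Submodule.span ℂ (Set.range fun p : E × E => bilinEval E p.1 p.2)).topologicalClosure

/-- The projective tensor square as a Banach space. -/
def ProjTensor : Type _ := projTensorSpace E

noncomputable instance : NormedAddCommGroup (ProjTensor E) :=
  inferInstanceAs (NormedAddCommGroup (projTensorSpace E))

noncomputable instance : NormedSpace ℂ (ProjTensor E) :=
  inferInstanceAs (NormedSpace ℂ (projTensorSpace E))

instance : CompleteSpace (ProjTensor E) :=
  (Submodule.isClosed_topologicalClosure _).completeSpace_coe

/-- The inclusion of the projective tensor square in the dual of the bounded bilinear forms. -/
noncomputable def projTensorIncl : ProjTensor E →ₗᵢ[ℂ] StrongDual ℂ (E →L[ℂ] E →L[ℂ] ℂ) :=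
  (projTensorSpace E).subtypeₗᵢ

variable {E}

theorem projTensorIncl_mem (x : ProjTensor E) : projTensorIncl E x ∈ projTensorSpace E := x.2

@[simp]
theorem bilinEval_apply (a b : E) (f : E →L[ℂ] E →L[ℂ] ℂ) : bilinEval E a b f = f a b := rfl

theorem norm_bilinEval_le (a b : E) : ‖bilinEval E a b‖ ≤ ‖a‖ * ‖b‖ :=
  ContinuousLinearMap.opNorm_le_bound _ (by positivity) fun f => by
    rw [bilinEval_apply]
    calc ‖f a b‖ ≤ ‖f‖ * ‖a‖ * ‖b‖ := f.le_opNorm₂ a b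
      _ = ‖a‖ * ‖b‖ * ‖f‖ := by ring

theorem norm_bilinEval (a b : E) : ‖bilinEval E a b‖ = ‖a‖ * ‖b‖ := by
  refine le_antisymm (norm_bilinEval_le a b) ?_
  obtain ⟨f, hf, hfa⟩ := exists_dual_vector'' ℂ a
  obtain ⟨g, hg, hgb⟩ := exists_dual_vector'' ℂ b
  have hs : ‖f.smulRight g‖ ≤ 1 := by
    rw [ContinuousLinearMap.norm_smulRight_apply]
    exact mul_le_one₀ hf (norm_nonneg _) hg
  have h := (bilinEval E a b).le_of_opNorm_le_of_le le_rfl hs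
  simpa [hfa, hgb] using h

theorem bilinEval_mem (a b : E) : bilinEval E a b ∈ projTensorSpace E :=
  Submodule.le_topologicalClosure _ (Submodule.subset_span ⟨(a, b), rfl⟩)

theorem exists_projTensorIncl_eq (a b : E) : ∃ x, projTensorIncl E x = bilinEval E a b :=
  ⟨⟨_, bilinEval_mem a b⟩, rfl⟩

/-- The elementary tensors. -/
noncomputable def projElem (a b : E) : ProjTensor E := (exists_projTensorIncl_eq a b).choose

@[simp]
theorem projTensorIncl_projElem (a b : E) :
    projTensorIncl E (projElem a b) = bilinEval E a b :=
  (exists_projTensorIncl_eq a b).choose_spec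

theorem norm_projElem (a b : E) : ‖projElem a b‖ = ‖a‖ * ‖b‖ := by
  rw [← (projTensorIncl E).norm_map, projTensorIncl_projElem, norm_bilinEval]

variable (E) in
/-- The canonical bilinear map into the projective tensor square. -/
noncomputable def projTmul : E →L[ℂ] E →L[ℂ] ProjTensor E :=
  LinearMap.mkContinuous₂
    (LinearMap.mk₂ ℂ projElem
      (fun _ _ _ => (projTensorIncl E).injective (by simp))
      (fun _ _ _ => (projTensorIncl E).injective (by simp))
      (fun _ _ _ => (projTensorIncl E).injective (by simp))
      (fun _ _ _ => (projTensorIncl E).injective (by simp))) 1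
    fun a b => by simp [norm_projElem]

theorem norm_projTmul (a b : E) : ‖projTmul E a b‖ = ‖a‖ * ‖b‖ := norm_projElem a b

theorem projTensorIncl_projTmul (a b : E) :
    projTensorIncl E (projTmul E a b) = bilinEval E a b := projTensorIncl_projElem a b

theorem dense_span_projTmul :
    Dense (Submodule.span ℂ (Set.range fun p : E × E => projTmul E p.1 p.2) :
      Set (ProjTensor E)) := by
  intro x
  rw [(projTensorIncl E).isometry.isUniformInducing.isInducing.closure_eq_preimage_closure_image,
    Set.mem_preimage]
  have h := Submodule.map_span (projTensorIncl E).toLinearMap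
    (Set.range fun p : E × E => projTmul E p.1 p.2)
  rw [← Set.range_comp] at h
  have himg : Set.image (projTensorIncl E) (Submodule.span ℂ
      (Set.range fun p : E × E => projTmul E p.1 p.2) : Set (ProjTensor E)) =
      (Submodule.span ℂ (Set.range fun p : E × E => bilinEval E p.1 p.2) : Set _) := by
    refine (congrArg SetLike.coe h).trans ?_
    congr 3
    ext1 p
    exact projTensorIncl_projTmul p.1 p.2
  rw [himg]
  exact projTensorIncl_mem x

theorem projTensor_ext {Y : Type*} [NormedAddCommGroup Y] [NormedSpace ℂ Y]
    {g h : ProjTensor E →L[ℂ] Y}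
    (H : ∀ a b, g (projTmul E a b) = h (projTmul E a b)) : g = h :=
  ContinuousLinearMap.ext_on dense_span_projTmul (by rintro _ ⟨p, rfl⟩; exact H p.1 p.2)

theorem exists_projTensor_lift {Y : Type*} [NormedAddCommGroup Y] [NormedSpace ℂ Y]
    [CompleteSpace Y] (f : E →L[ℂ] E →L[ℂ] Y) :
    ∃ g : ProjTensor E →L[ℂ] Y, ‖g‖ ≤ ‖f‖ ∧ ∀ a b, g (projTmul E a b) = f a b := by
  let J := NormedSpace.inclusionInDoubleDualLi (E := Y) ℂ
  let H : StrongDual ℂ Y →L[ℂ] E →L[ℂ] E →L[ℂ] ℂ :=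
    (ContinuousLinearMap.compL ℂ E (E →L[ℂ] Y) (E →L[ℂ] ℂ)).flip f ∘L
      ContinuousLinearMap.compL ℂ E Y ℂ
  let G : StrongDual ℂ (E →L[ℂ] E →L[ℂ] ℂ) →L[ℂ] StrongDual ℂ (StrongDual ℂ Y) :=
    (ContinuousLinearMap.compL ℂ (StrongDual ℂ Y) (E →L[ℂ] E →L[ℂ] ℂ) ℂ).flip H
  have hH : ‖H‖ ≤ ‖f‖ := by
    refine ContinuousLinearMap.opNorm_le_bound _ (norm_nonneg _) fun l => ?_
    refine ContinuousLinearMap.opNorm_le_bound₂ _ (by positivity) fun a b => ?_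
    calc ‖l (f a b)‖ ≤ ‖l‖ * (‖f‖ * ‖a‖ * ‖b‖) := l.le_opNorm_of_le (f.le_opNorm₂ a b)
      _ = ‖f‖ * ‖l‖ * ‖a‖ * ‖b‖ := by ring
  have hGx (x) : ‖G x‖ ≤ ‖f‖ * ‖x‖ := by
    calc ‖G x‖ ≤ ‖x‖ * ‖H‖ := ContinuousLinearMap.opNorm_comp_le _ _
      _ ≤ ‖f‖ * ‖x‖ := by rw [mul_comm]; gcongr
  have hGt (a b : E) : G (bilinEval E a b) = J (f a b) := rfl
  have hclosed : IsClosed (LinearMap.range J.toLinearMap :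
      Set (StrongDual ℂ (StrongDual ℂ Y))) := by
    have := J.isometry.isClosedEmbedding.isClosed_range
    rwa [← LinearIsometry.coe_toLinearMap, ← LinearMap.coe_range] at this
  have hle : projTensorSpace E ≤ (LinearMap.range J.toLinearMap).comap G.toLinearMap := by
    refine Submodule.topologicalClosure_minimal _ (Submodule.span_le.2 ?_)
      (hclosed.preimage G.continuous)
    rintro _ ⟨p, rfl⟩
    exact ⟨f p.1 p.2, (hGt p.1 p.2).symm⟩
  choose g hg using fun x : ProjTensor E => hle (projTensorIncl_mem x)
  replace hg (x) : J (g x) = G (projTensorIncl E x) := hg x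
  have hnorm (x) : ‖g x‖ ≤ ‖f‖ * ‖x‖ := by
    rw [← J.norm_map, hg, ← (projTensorIncl E).norm_map x]
    exact hGx _
  refine ⟨LinearMap.mkContinuous
    { toFun := g
      map_add' := fun x y => J.injective (by simp [hg])
      map_smul' := fun c x => J.injective (by simp [hg]) } ‖f‖ hnorm,
    LinearMap.mkContinuous_norm_le _ (norm_nonneg _) _, fun a b => J.injective ?_⟩
  refine (hg _).trans ?_
  rw [projTensorIncl_projTmul]
  exact hGt a b

/-- The linearization of bounded bilinear maps, as a bounded linear map. -/
theorem exists_projTensor_liftL (Y : Type*) [NormedAddCommGroup Y] [NormedSpace ℂ Y]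
    [CompleteSpace Y] :
    ∃ L : (E →L[ℂ] E →L[ℂ] Y) →L[ℂ] (ProjTensor E →L[ℂ] Y),
      ∀ f a b, L f (projTmul E a b) = f a b := by
  choose g hgn hg using fun f : E →L[ℂ] E →L[ℂ] Y => exists_projTensor_lift f
  exact ⟨LinearMap.mkContinuous
    { toFun := g
      map_add' := fun x y => projTensor_ext (by simp [hg])
      map_smul' := fun c x => projTensor_ext (by simp [hg]) } 1
    (fun f => by simpa using hgn f), hg⟩

theorem nonempty_projTensorSq (A : Type u) [NonUnitalNormedRing A] [NormedSpace ℂ A]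
    [IsScalarTower ℂ A A] [SMulCommClass ℂ A A] [CompleteSpace A] :
    Nonempty (ProjTensorSq A (ProjTensor A)) := by
  obtain ⟨L, hL⟩ := exists_projTensor_liftL (E := A) (ProjTensor A)
  obtain ⟨M, hM⟩ := exists_projTensor_liftL (E := A) A
  exact ⟨{
    tmul := projTmul A
    norm_tmul := norm_projTmul
    dense_span := dense_span_projTmul
    universal := fun _ _ _ _ f => exists_projTensor_lift f
    lsmul := L ∘L ContinuousLinearMap.compL ℂ A A (A →L[ℂ] ProjTensor A) (projTmul A) ∘L
      ContinuousLinearMap.mul ℂ A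
    lsmul_tmul := fun a b c => hL _ b c
    rsmul := L ∘L (ContinuousLinearMap.compL ℂ A A (ProjTensor A) ∘L projTmul A).flip ∘L
      (ContinuousLinearMap.mul ℂ A).flip
    rsmul_tmul := fun a b c => hL _ b c
    projL := M (ContinuousLinearMap.mul ℂ A)
    projL_tmul := fun a b => hM _ a b }⟩

end Construction

theorem ProjTensorSq.hom_ext {A X : Type u} {Y : Type*} [NonUnitalNormedRing A] [NormedSpace ℂ A]
    [IsScalarTower ℂ A A] [SMulCommClass ℂ A A] [NormedAddCommGroup X] [NormedSpace ℂ X]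
    [CompleteSpace X] [NormedAddCommGroup Y] [NormedSpace ℂ Y] (P : ProjTensorSq A X)
    {g h : X →L[ℂ] Y} (H : ∀ a b, g (P.tmul a b) = h (P.tmul a b)) : g = h :=
  ContinuousLinearMap.ext_on P.dense_span (by rintro _ ⟨p, rfl⟩; exact H p.1 p.2)

/-- A bounded linear map whose values lie in the range of a linear isometry factors through
it. -/
theorem exists_lift_of_isometry {E F G : Type*} [NormedAddCommGroup E] [NormedSpace ℂ E]
    [NormedAddCommGroup F] [NormedSpace ℂ F] [NormedAddCommGroup G] [NormedSpace ℂ G]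
    (j : F →ₗᵢ[ℂ] G) (f : E →L[ℂ] G) (h : ∀ x, ∃ y, j y = f x) :
    ∃ g : E →L[ℂ] F, ∀ x, j (g x) = f x := by
  choose g hg using h
  exact ⟨LinearMap.mkContinuous
    { toFun := g
      map_add' := fun x y => j.injective (by simp [hg])
      map_smul' := fun c x => j.injective (by simp [hg]) } ‖f‖
    (fun x => by
      have := f.le_opNorm x
      rwa [← hg, j.norm_map] at this), hg⟩

/-- Proposition 2.8.  Let `A` be a Banach algebra, `φ ∈ Δ(A)`, and let
`I` be a closed two-sided ideal of `A` with `φ|_I ≠ 0`.  If `A` is approximately left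
`φ`-biprojective, then the Banach algebra `I` is approximately left `φ|_I`-biprojective.

Here the closed ideal is encoded as a Banach algebra `I` together with an isometric
algebra monomorphism `j : I → A` whose range is a two-sided ideal of `A`, and `ψ ∈ Δ(I)`
is the restriction `φ ∘ j` of `φ` along this embedding. -/
theorem approxLeftBiprojective_closed_ideal
    {A : Type u} [NonUnitalNormedRing A] [NormedSpace ℂ A]
    [IsScalarTower ℂ A A] [SMulCommClass ℂ A A] [CompleteSpace A]
    (I : Type u) [NonUnitalNormedRing I] [NormedSpace ℂ I]
    [IsScalarTower ℂ I I] [SMulCommClass ℂ I I] [CompleteSpace I]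
    (j : I →ₗ[ℂ] A)
    (hj_isometry : ∀ x : I, ‖j x‖ = ‖x‖)
    (hj_mul : ∀ x y : I, j (x * y) = j x * j y)
    (hj_ideal_left : ∀ (a : A) (x : I), ∃ y : I, j y = a * j x)
    (hj_ideal_right : ∀ (a : A) (x : I), ∃ y : I, j y = j x * a)
    (φ : WeakDual.characterSpace ℂ A)
    (hφI : ∃ x : I, φ (j x) ≠ 0)
    (ψ : WeakDual.characterSpace ℂ I)
    (hψ : ∀ x : I, ψ x = φ (j x))
    (hA : ApproxLeftBiprojective φ) :
    ApproxLeftBiprojective ψ := by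
  intro X _ _ _ P
  obtain ⟨Q⟩ := nonempty_projTensorSq A
  obtain ⟨D, ρ, h1, h2, h3⟩ := hA _ Q
  obtain ⟨e, he⟩ : ∃ e : I, φ (j e) = 1 := by
    obtain ⟨x, hx⟩ := hφI
    exact ⟨(φ (j x))⁻¹ • x, by rw [map_smul, map_smul, smul_eq_mul, inv_mul_cancel₀ hx]⟩
  let J : I →ₗᵢ[ℂ] A := ⟨j, hj_isometry⟩
  obtain ⟨l, hl⟩ := exists_lift_of_isometry J ((ContinuousLinearMap.mul ℂ A).flip (j e))
    (fun a => hj_ideal_left a e)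
  obtain ⟨r, hr⟩ := exists_lift_of_isometry J (ContinuousLinearMap.mul ℂ A (j e))
    (fun a => hj_ideal_right a e)
  replace hl (a) : j (l a) = a * j e := hl a
  replace hr (a) : j (r a) = j e * a := hr a
  obtain ⟨T, -, hT⟩ := Q.universal X (P.tmul.bilinearComp l r)
  replace hT (a b) : T (Q.tmul a b) = P.tmul (l a) (r b) := hT a b
  have hTl (a : I) (z) : P.lsmul a (T z) = T (Q.lsmul (j a) z) := by
    have : P.lsmul a ∘L T = T ∘L Q.lsmul (j a) := Q.hom_ext fun b c => by
      have hlm : a * l b = l (j a * b) := J.injective (by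
        change j _ = j _
        rw [hj_mul, hl, hl, mul_assoc])
      simp [hT, P.lsmul_tmul, Q.lsmul_tmul, hlm]
    exact DFunLike.congr_fun this z
  have hTπ (z) : ψ (P.projL (T z)) = φ (Q.projL z) := by
    let ψL : I →L[ℂ] ℂ := WeakDual.toStrongDual (ψ : WeakDual ℂ I)
    let φL : A →L[ℂ] ℂ := WeakDual.toStrongDual (φ : WeakDual ℂ A)
    have : ψL ∘L P.projL ∘L T = φL ∘L Q.projL := Q.hom_ext fun b c => by
      change ψ (P.projL (T (Q.tmul b c))) = φ (Q.projL (Q.tmul b c))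
      simp [hT, P.projL_tmul, Q.projL_tmul, hψ, hj_mul, hl, hr, he]
    exact DFunLike.congr_fun this z
  have hT0 : Tendsto T (𝓝 0) (𝓝 0) := by simpa using T.continuous.tendsto 0
  let jL : I →L[ℂ] A := J.toContinuousLinearMap
  refine ⟨D, fun i => T ∘L ρ i ∘L jL, fun a x => ?_, fun a x => ?_, fun x => ?_⟩
  · refine (hT0.comp (h1 (j a) (j x))).congr fun i => ?_
    change T _ = P.lsmul a (T (ρ i (j x))) - T (ρ i (j (a * x)))
    rw [map_sub, hTl, hj_mul]
  · refine (hT0.comp (h2 (j a) (j x))).congr fun i => ?_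
    change T _ = T (ρ i (j (x * a))) - ψ a • T (ρ i (j x))
    rw [map_sub, map_smul, hj_mul, hψ]
  · rw [hψ]
    refine (h3 (j x)).congr fun i => ?_
    exact (hTπ _).symm
end
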